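/- Let a_x, a_y, A_x, A_y, B̃_x, B̃_y be as follows: for reals K_x, K_y ≥ 0 and Ω_x, Ω_y > 0, set a_x = (1+K_x)/Ω_x, a_y = (1+K_y)/Ω_y, A_x = a_x e^{−K_x}, A_y = a_y e^{−K_y}, B̃_x(n) = ((K_x(1+K_x)/Ω_x)ⁿ/(n!)²)/a_x, B̃_y(k) = ((K_y(1+K_y)/Ω_y)^k/(k!)²)/a_y. Let Z be a nonnegative real-valued random variable whose tail satisfies P(Z > z) = A_x A_y ∑_{n=0}^∞ ∑_{k=0}^∞ B̃_x(n) B̃_y(k) Γ(n+1, a_x z) Γ(k+1, a_y z) for all z ≥ 0. Then for all reals ρ > 0 and 0 < a₂ < 1, the average achievable rate C₁ = (1/2)·E[log₂(1+ρZ) − log₂(1+ρa₂Z)] is finite and equals (1/(2 ln 2)) · (D(ρ) − D(ρa₂)), where for any s > 0, D(s) = A_x A_y ∑_{n=0}^∞ ∑_{k=0}^∞ B̃_x(n) B̃_y(k) n! k! ∑_{i=0}^{n} ∑_{j=0}^{k} ((i+j)!/(i!j!)) (a_xⁱ a_y^j / s^{i+j}) e^{(a_x+a_y)/s} Γ(−(i+j),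 (a_x+a_y)/s). -/

import Mathlib

open MeasureTheory Real Set Finset

/-- Upper incomplete Gamma function `Γ(n+1, x) = ∫_x^∞ tⁿ e^{-t} dt`. -/
noncomputable def uiGamma (n : ℕ) (x : ℝ) : ℝ :=
  ∫ t in Set.Ioi x, t ^ n * Real.exp (-t)

/-- Upper incomplete Gamma function of negative integer order:
    `Γ(-m, β) = ∫_β^∞ e^{-t} / t^{m+1} dt`. -/
noncomputable def uiGammaNeg (m : ℕ) (β : ℝ) : ℝ :=
  ∫ t in Set.Ioi β, Real.exp (-t) / t ^ (m + 1)

open Filter Topology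

lemma integrableOn_pow_mul_exp_neg_mul {c : ℝ} (hc : 0 < c) (n : ℕ) :
    IntegrableOn (fun t : ℝ => t ^ n * Real.exp (-(c * t))) (Set.Ioi 0) := by
  have h := integrableOn_rpow_mul_exp_neg_mul_rpow (p := 1) (s := n) (b := c)
    (by linarith [n.cast_nonneg (α := ℝ)]) one_pos hc
  simpa only [Real.rpow_natCast, Real.rpow_one, neg_mul] using h

lemma integral_pow_mul_exp_neg_mul {c : ℝ} (hc : 0 < c) (n : ℕ) :
    ∫ t in Set.Ioi (0 : ℝ), t ^ n * Real.exp (-(c * t)) = n.factorial / c ^ (n + 1) := by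
  have h := Real.integral_rpow_mul_exp_neg_mul_Ioi (a := n + 1) (r := c) (by positivity) hc
  rw [Real.Gamma_nat_eq_factorial, add_sub_cancel_right] at h
  simp only [Real.rpow_natCast] at h
  rw [h, ← Nat.cast_add_one, Real.rpow_natCast, one_div, inv_pow]
  field_simp

lemma integrableOn_Ioi_pow_mul_exp_neg (n : ℕ) (x : ℝ) :
    IntegrableOn (fun t : ℝ => t ^ n * Real.exp (-t)) (Set.Ioi x) := by
  have h0 : IntegrableOn (fun t : ℝ => t ^ n * Real.exp (-t)) (Set.Ioi 0) := by
    simpa using integrableOn_pow_mul_exp_neg_mul one_pos n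
  have h1 : IntegrableOn (fun t : ℝ => t ^ n * Real.exp (-t)) (Set.Icc x 0) :=
    (by fun_prop : Continuous fun t : ℝ => t ^ n * Real.exp (-t)).continuousOn.integrableOn_Icc
  refine (h1.union h0).mono_set fun t ht => ?_
  rcases le_or_gt t 0 with h | h
  · exact Or.inl ⟨le_of_lt ht, h⟩
  · exact Or.inr h

lemma uiGamma_succ (n : ℕ) (x : ℝ) :
    uiGamma (n + 1) x = x ^ (n + 1) * Real.exp (-x) + (n + 1) * uiGamma n x := by
  have hi := (integrableOn_Ioi_pow_mul_exp_neg (n + 1) x)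
  have hi' := (integrableOn_Ioi_pow_mul_exp_neg n x).const_mul ((n : ℝ) + 1)
  have h := integral_Ioi_of_hasDerivAt_of_tendsto' (a := x) (m := 0)
    (f := fun t : ℝ => t ^ (n + 1) * Real.exp (-t))
    (f' := fun t : ℝ => (n + 1) * (t ^ n * Real.exp (-t)) - t ^ (n + 1) * Real.exp (-t))
    (fun t _ => by
      have := (hasDerivAt_pow (n + 1) t).mul ((Real.hasDerivAt_exp (-t)).comp t (hasDerivAt_neg t))
      convert! this using 1
      push_cast
      simp
      ring)
    (hi'.sub hi) (Real.tendsto_pow_mul_exp_neg_atTop_nhds_zero (n + 1))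
  rw [integral_sub hi' hi, integral_const_mul] at h
  unfold uiGamma
  linarith

lemma uiGamma_eq_sum (n : ℕ) (x : ℝ) :
    uiGamma n x =
      n.factorial * (Real.exp (-x) * ∑ i ∈ Finset.range (n + 1), x ^ i / i.factorial) := by
  induction n with
  | zero =>
    simp only [uiGamma, pow_zero, one_mul]
    rw [integral_exp_neg_Ioi]
    simp
  | succ n ih =>
    rw [uiGamma_succ, ih, Finset.sum_range_succ _ (n + 1), Nat.factorial_succ]
    push_cast
    field_simp
    ring

lemma uiGamma_nonneg (n : ℕ) {x : ℝ} (hx : 0 ≤ x) : 0 ≤ uiGamma n x := by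
  rw [uiGamma_eq_sum]
  positivity

lemma continuous_uiGamma (n : ℕ) : Continuous (uiGamma n) := by
  rw [funext (uiGamma_eq_sum n)]
  fun_prop

lemma uiGamma_le (n : ℕ) {x : ℝ} (hx : 0 ≤ x) :
    uiGamma n x ≤ n.factorial * 2 ^ n * Real.exp (-(x / 2)) := by
  have hsum : ∑ i ∈ Finset.range (n + 1), x ^ i / i.factorial ≤ 2 ^ n * Real.exp (x / 2) := by
    calc ∑ i ∈ Finset.range (n + 1), x ^ i / (i.factorial : ℝ)
        ≤ ∑ i ∈ Finset.range (n + 1), 2 ^ n * ((x / 2) ^ i / i.factorial) := by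
          refine Finset.sum_le_sum fun i hi => ?_
          have h2 : (2 : ℝ) ^ i ≤ 2 ^ n :=
            pow_le_pow_right₀ one_le_two (Nat.lt_succ_iff.mp (Finset.mem_range.mp hi))
          calc x ^ i / (i.factorial : ℝ) = 2 ^ i * ((x / 2) ^ i / i.factorial) := by
                rw [div_pow]; field_simp
            _ ≤ _ := by gcongr
      _ ≤ 2 ^ n * Real.exp (x / 2) := by
          rw [← Finset.mul_sum]
          gcongr
          exact Real.sum_le_exp_of_nonneg (by positivity) _
  calc uiGamma n x ≤ n.factorial * (Real.exp (-x) * (2 ^ n * Real.exp (x / 2))) := by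
        rw [uiGamma_eq_sum]; gcongr
    _ = n.factorial * 2 ^ n * (Real.exp (-x) * Real.exp (x / 2)) := by ring
    _ = _ := by rw [← Real.exp_add]; ring_nf

lemma integrableOn_exp_neg_div_pow (m : ℕ) {β : ℝ} (hβ : 0 < β) :
    IntegrableOn (fun t : ℝ => Real.exp (-t) / t ^ m) (Set.Ioi β) := by
  have h : IntegrableOn (fun t : ℝ => Real.exp (-t) * (1 / β ^ m)) (Set.Ioi β) :=
    Integrable.mul_const (by simpa using! integrableOn_Ioi_pow_mul_exp_neg 0 β) _
  refine h.mono' (Measurable.aestronglyMeasurable (by fun_prop)) ?_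
  refine (ae_restrict_iff' measurableSet_Ioi).mpr (.of_forall fun t (ht : β < t) => ?_)
  have ht0 := hβ.trans ht
  rw [Real.norm_of_nonneg (by positivity), div_eq_mul_one_div]
  gcongr

lemma uiGammaNeg_succ (m : ℕ) {β : ℝ} (hβ : 0 < β) :
    (m + 1) * uiGammaNeg (m + 1) β = Real.exp (-β) / β ^ (m + 1) - uiGammaNeg m β := by
  have hi := integrableOn_exp_neg_div_pow (m + 1) hβ
  have hi' := (integrableOn_exp_neg_div_pow (m + 1 + 1) hβ).const_mul ((m : ℝ) + 1)
  have h := integral_Ioi_of_hasDerivAt_of_tendsto' (a := β) (m := 0)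
    (f := fun t : ℝ => Real.exp (-t) / t ^ (m + 1))
    (f' := fun t : ℝ => -(Real.exp (-t) / t ^ (m + 1)) -
      (m + 1) * (Real.exp (-t) / t ^ (m + 1 + 1)))
    (fun t ht => by
      have ht0 : t ≠ 0 := (hβ.trans_le ht).ne'
      have := ((Real.hasDerivAt_exp (-t)).comp t (hasDerivAt_neg t)).div
        (hasDerivAt_pow (m + 1) t) (pow_ne_zero _ ht0)
      convert! this using 1
      push_cast
      simp
      field_simp
      ring)
    (hi.neg.sub hi') (by
      refine Tendsto.div_atTop (a := 0) ?_ (tendsto_pow_atTop m.succ_ne_zero)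
      simpa using Real.tendsto_pow_mul_exp_neg_atTop_nhds_zero 0)
  rw [integral_sub (f := fun t => -(Real.exp (-t) / t ^ (m + 1))) hi.neg hi',
    integral_const_mul, integral_neg] at h
  unfold uiGammaNeg
  linarith

lemma integrableOn_pow_mul_exp_mul_div {c s : ℝ} (hc : 0 < c) (hs : 0 < s) (m : ℕ) :
    IntegrableOn (fun t : ℝ => t ^ m * Real.exp (-(c * t)) * (s / (1 + s * t))) (Set.Ioi 0) := by
  refine ((integrableOn_pow_mul_exp_neg_mul hc m).mul_const s).mono' (by measurability) ?_
  refine (ae_restrict_iff' measurableSet_Ioi).mpr (.of_forall fun t (ht : 0 < t) => ?_)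
  rw [Real.norm_of_nonneg (by positivity)]
  gcongr
  exact div_le_self hs.le (by nlinarith [mul_pos hs ht])

lemma integral_pow_mul_exp_mul_div {c s : ℝ} (hc : 0 < c) (hs : 0 < s) (m : ℕ) :
    ∫ t in Set.Ioi (0 : ℝ), t ^ m * Real.exp (-(c * t)) * (s / (1 + s * t)) =
      m.factorial / s ^ m * Real.exp (c / s) * uiGammaNeg m (c / s) := by
  induction m with
  | zero =>
    have h1 := integral_comp_mul_left_Ioi
      (fun u : ℝ => Real.exp (c / s) * (Real.exp (-(u + c / s)) / (u + c / s))) 0 hc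
    have h2 := (measurePreserving_add_right (volume : Measure ℝ) (c / s)).setIntegral_preimage_emb
      (measurableEmbedding_addRight (c / s)) (fun u => Real.exp (-u) / u) (Set.Ioi (c / s))
    simp only [Set.preimage_add_const_Ioi, sub_self] at h2
    rw [mul_zero, integral_const_mul, integral_const_mul, h2] at h1
    simp only [uiGammaNeg, Nat.factorial_zero, pow_zero, zero_add, pow_one, Nat.cast_one, div_one,
      one_mul]
    rw [eq_comm, ← smul_right_inj (inv_ne_zero hc.ne'), ← h1, smul_eq_mul, ← integral_const_mul,
      ← integral_const_mul]
    refine setIntegral_congr_fun measurableSet_Ioi fun t (ht : 0 < t) => ?_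
    have : Real.exp (-(c * t)) = Real.exp (c / s) * Real.exp (-(c * t + c / s)) := by
      rw [← Real.exp_add]; ring_nf
    simp only [this]
    field_simp
    ring
  | succ m ih =>
    have hi := integrableOn_pow_mul_exp_neg_mul hc m
    have hJ := (integrableOn_pow_mul_exp_mul_div hc hs m).mul_const (1 / s)
    have hrec : ∫ t in Set.Ioi (0 : ℝ), t ^ (m + 1) * Real.exp (-(c * t)) * (s / (1 + s * t)) =
        m.factorial / c ^ (m + 1) -
          (m.factorial / s ^ m * Real.exp (c / s) * uiGammaNeg m (c / s)) * (1 / s) := by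
      rw [← ih, ← integral_pow_mul_exp_neg_mul hc, ← integral_mul_const, ← integral_sub hi hJ]
      refine setIntegral_congr_fun measurableSet_Ioi fun t (ht : 0 < t) => ?_
      have : 1 + s * t ≠ 0 := by positivity
      field_simp
      ring
    have hG := uiGammaNeg_succ m (div_pos hc hs)
    rw [hrec, Nat.factorial_succ]
    have hG' : uiGammaNeg m (c / s) = Real.exp (-(c / s)) / (c / s) ^ (m + 1) -
        (m + 1) * uiGammaNeg (m + 1) (c / s) := by linarith
    rw [hG']
    push_cast
    rw [Real.exp_neg]
    generalize uiGammaNeg (m + 1) (c / s) = G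
    have hE := Real.exp_ne_zero (c / s)
    generalize Real.exp (c / s) = E at *
    rw [div_pow]
    field_simp
    ring

lemma uiGamma_mul_uiGamma_mul_div (a b s t : ℝ) (n k : ℕ) :
    uiGamma n (a * t) * uiGamma k (b * t) * (s / (1 + s * t)) =
      n.factorial * k.factorial * ∑ i ∈ Finset.range (n + 1), ∑ j ∈ Finset.range (k + 1),
        a ^ i * b ^ j / (i.factorial * j.factorial) *
          (t ^ (i + j) * Real.exp (-((a + b) * t)) * (s / (1 + s * t))) := by
  have he : Real.exp (-((a + b) * t)) = Real.exp (-(a * t)) * Real.exp (-(b * t)) := by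
    rw [← Real.exp_add]; ring_nf
  have hsum : ∑ i ∈ Finset.range (n + 1), ∑ j ∈ Finset.range (k + 1),
        a ^ i * b ^ j / (i.factorial * j.factorial) *
          (t ^ (i + j) * Real.exp (-((a + b) * t)) * (s / (1 + s * t))) =
      (∑ i ∈ Finset.range (n + 1), (a * t) ^ i / i.factorial) *
        (∑ j ∈ Finset.range (k + 1), (b * t) ^ j / j.factorial) *
        (Real.exp (-(a * t)) * Real.exp (-(b * t)) * (s / (1 + s * t))) := by
    rw [Finset.sum_mul_sum, Finset.sum_mul]
    refine Finset.sum_congr rfl fun i _ => ?_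
    rw [Finset.sum_mul]
    refine Finset.sum_congr rfl fun j _ => ?_
    rw [he, mul_pow, mul_pow, pow_add, mul_div_mul_comm, mul_div_right_comm, mul_div_right_comm]
    ring
  rw [hsum, uiGamma_eq_sum, uiGamma_eq_sum]
  ring

lemma integrableOn_uiGamma_mul_uiGamma_mul_div {a b s : ℝ} (ha : 0 < a) (hb : 0 < b) (hs : 0 < s)
    (n k : ℕ) :
    IntegrableOn (fun t => uiGamma n (a * t) * uiGamma k (b * t) * (s / (1 + s * t)))
      (Set.Ioi 0) := by
  simp only [uiGamma_mul_uiGamma_mul_div]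
  exact (integrable_finsetSum _ fun i _ => integrable_finsetSum _ fun j _ =>
    (integrableOn_pow_mul_exp_mul_div (add_pos ha hb) hs (i + j)).const_mul _).const_mul _

lemma integral_uiGamma_mul_uiGamma_mul_div {a b s : ℝ} (ha : 0 < a) (hb : 0 < b) (hs : 0 < s)
    (n k : ℕ) :
    ∫ t in Set.Ioi (0 : ℝ), uiGamma n (a * t) * uiGamma k (b * t) * (s / (1 + s * t)) =
      n.factorial * k.factorial * ∑ i ∈ Finset.range (n + 1), ∑ j ∈ Finset.range (k + 1),
        (((i + j).factorial : ℝ) / (i.factorial * j.factorial)) *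
          (a ^ i * b ^ j / s ^ (i + j)) * Real.exp ((a + b) / s) *
          uiGammaNeg (i + j) ((a + b) / s) := by
  have hint (i j : ℕ) := (integrableOn_pow_mul_exp_mul_div (add_pos ha hb) hs (i + j)).const_mul
    (a ^ i * b ^ j / (i.factorial * j.factorial))
  simp only [uiGamma_mul_uiGamma_mul_div]
  rw [integral_const_mul,
    integral_finsetSum _ fun i _ => integrable_finsetSum _ fun j _ => hint i j]
  congr 1
  refine Finset.sum_congr rfl fun i _ => ?_
  rw [integral_finsetSum _ fun j _ => hint i j]
  refine Finset.sum_congr rfl fun j _ => ?_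
  rw [integral_const_mul, integral_pow_mul_exp_mul_div (add_pos ha hb) hs]
  ring

section Series

variable {a b s : ℝ} {p q : ℕ → ℝ}

lemma uiGamma_mul_uiGamma_term_le (ha : 0 < a) (hb : 0 < b) (hp : ∀ n, 0 ≤ p n)
    (hq : ∀ k, 0 ≤ q k) {t : ℝ} (ht : 0 ≤ t) (n k : ℕ) :
    p n * q k * uiGamma n (a * t) * uiGamma k (b * t) ≤
      p n * n.factorial * 2 ^ n * (q k * k.factorial * 2 ^ k) *
        Real.exp (-((a + b) / 2 * t)) := by
  have he : Real.exp (-((a + b) / 2 * t)) =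
      Real.exp (-(a * t / 2)) * Real.exp (-(b * t / 2)) := by
    rw [← Real.exp_add]; ring_nf
  have hn := uiGamma_le n (mul_nonneg ha.le ht)
  have hk := uiGamma_le k (mul_nonneg hb.le ht)
  have hk0 := uiGamma_nonneg k (mul_nonneg hb.le ht)
  have := hp n
  have := hq k
  calc p n * q k * uiGamma n (a * t) * uiGamma k (b * t)
      ≤ p n * q k * (n.factorial * 2 ^ n * Real.exp (-(a * t / 2))) *
        (k.factorial * 2 ^ k * Real.exp (-(b * t / 2))) := by gcongr
    _ = _ := by rw [he]; ring

lemma uiGamma_mul_uiGamma_term_nonneg (ha : 0 < a) (hb : 0 < b) (hp : ∀ n, 0 ≤ p n)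
    (hq : ∀ k, 0 ≤ q k) {t : ℝ} (ht : 0 ≤ t) (n k : ℕ) :
    0 ≤ p n * q k * uiGamma n (a * t) * uiGamma k (b * t) :=
  mul_nonneg (mul_nonneg (mul_nonneg (hp n) (hq k)) (uiGamma_nonneg n (mul_nonneg ha.le ht)))
    (uiGamma_nonneg k (mul_nonneg hb.le ht))

lemma summable_weights_prod (hp : ∀ n, 0 ≤ p n) (hq : ∀ k, 0 ≤ q k)
    (hps : Summable fun n => p n * n.factorial * 2 ^ n)
    (hqs : Summable fun k => q k * k.factorial * 2 ^ k) :
    Summable fun x : ℕ × ℕ =>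
      p x.1 * x.1.factorial * 2 ^ x.1 * (q x.2 * x.2.factorial * 2 ^ x.2) :=
  hps.mul_of_nonneg hqs (fun n => by have := hp n; positivity)
    (fun k => by have := hq k; positivity)

lemma summable_uiGamma_mul_uiGamma (ha : 0 < a) (hb : 0 < b) (hp : ∀ n, 0 ≤ p n)
    (hq : ∀ k, 0 ≤ q k) (hps : Summable fun n => p n * n.factorial * 2 ^ n)
    (hqs : Summable fun k => q k * k.factorial * 2 ^ k) {t : ℝ} (ht : 0 ≤ t) :
    Summable fun x : ℕ × ℕ => p x.1 * q x.2 * uiGamma x.1 (a * t) * uiGamma x.2 (b * t) :=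
  .of_nonneg_of_le (fun _ => uiGamma_mul_uiGamma_term_nonneg ha hb hp hq ht _ _)
    (fun _ => uiGamma_mul_uiGamma_term_le ha hb hp hq ht _ _)
    ((summable_weights_prod hp hq hps hqs).mul_right _)

lemma integrableOn_exp_neg_mul_mul_const {c : ℝ} (hc : 0 < c) (C : ℝ) :
    IntegrableOn (fun t : ℝ => C * Real.exp (-(c * t)) * s) (Set.Ioi 0) := by
  simpa using! ((integrableOn_pow_mul_exp_neg_mul hc 0).const_mul C).mul_const s

lemma div_one_add_mul_le (hs : 0 < s) {t : ℝ} (ht : 0 ≤ t) : s / (1 + s * t) ≤ s :=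
  div_le_self hs.le (by nlinarith [mul_nonneg hs.le ht])

lemma integrableOn_tsum_uiGamma_mul_div (ha : 0 < a) (hb : 0 < b) (hs : 0 < s)
    (hp : ∀ n, 0 ≤ p n) (hq : ∀ k, 0 ≤ q k)
    (hps : Summable fun n => p n * n.factorial * 2 ^ n)
    (hqs : Summable fun k => q k * k.factorial * 2 ^ k) :
    IntegrableOn (fun t => (∑' n, ∑' k, p n * q k * uiGamma n (a * t) * uiGamma k (b * t)) *
      (s / (1 + s * t))) (Set.Ioi 0) := by
  have hv := summable_weights_prod hp hq hps hqs
  refine (integrableOn_exp_neg_mul_mul_const (s := s) (half_pos (add_pos ha hb))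
    (∑' x : ℕ × ℕ, p x.1 * x.1.factorial * 2 ^ x.1 *
      (q x.2 * x.2.factorial * 2 ^ x.2))).mono' ?_ ?_
  · refine Measurable.aestronglyMeasurable (.mul (.tsum fun n => .tsum fun k => ?_) (by fun_prop))
    have := (continuous_uiGamma n).measurable
    have := (continuous_uiGamma k).measurable
    fun_prop
  · refine (ae_restrict_iff' measurableSet_Ioi).mpr (.of_forall fun t (ht : 0 < t) => ?_)
    have hS := summable_uiGamma_mul_uiGamma ha hb hp hq hps hqs ht.le
    have h0 : 0 ≤ ∑' x : ℕ × ℕ, p x.1 * q x.2 * uiGamma x.1 (a * t) * uiGamma x.2 (b * t) :=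
      tsum_nonneg fun x => uiGamma_mul_uiGamma_term_nonneg ha hb hp hq ht.le x.1 x.2
    rw [← hS.tsum_prod, Real.norm_of_nonneg (by positivity),
      ← tsum_mul_right (a := Real.exp _)]
    refine mul_le_mul ?_ (div_one_add_mul_le hs ht.le) (by positivity)
      (tsum_nonneg fun x => ?_)
    · exact hS.tsum_le_tsum (fun x => uiGamma_mul_uiGamma_term_le ha hb hp hq ht.le x.1 x.2)
        (hv.mul_right _)
    · have := hp x.1
      have := hq x.2
      positivity

lemma integral_tsum_uiGamma_mul_div (ha : 0 < a) (hb : 0 < b) (hs : 0 < s)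
    (hp : ∀ n, 0 ≤ p n) (hq : ∀ k, 0 ≤ q k)
    (hps : Summable fun n => p n * n.factorial * 2 ^ n)
    (hqs : Summable fun k => q k * k.factorial * 2 ^ k) :
    ∫ t in Set.Ioi (0 : ℝ),
        (∑' n, ∑' k, p n * q k * uiGamma n (a * t) * uiGamma k (b * t)) * (s / (1 + s * t)) =
      ∑' n, ∑' k, p n * q k * (n.factorial * k.factorial *
        ∑ i ∈ Finset.range (n + 1), ∑ j ∈ Finset.range (k + 1),
          (((i + j).factorial : ℝ) / (i.factorial * j.factorial)) *
            (a ^ i * b ^ j / s ^ (i + j)) * Real.exp ((a + b) / s) *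
            uiGammaNeg (i + j) ((a + b) / s)) := by
  have hv := summable_weights_prod hp hq hps hqs
  let F : ℕ × ℕ → ℝ → ℝ := fun x t =>
    p x.1 * q x.2 * (uiGamma x.1 (a * t) * uiGamma x.2 (b * t) * (s / (1 + s * t)))
  have hF (x : ℕ × ℕ) : IntegrableOn (F x) (Set.Ioi 0) :=
    (integrableOn_uiGamma_mul_uiGamma_mul_div ha hb hs x.1 x.2).const_mul _
  have hF_sum : Summable fun x => ∫ t in Set.Ioi (0 : ℝ), ‖F x t‖ := by
    refine .of_nonneg_of_le (fun x => integral_nonneg fun t => norm_nonneg _) (fun x => ?_)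
      (hv.mul_right (∫ t in Set.Ioi (0 : ℝ), 1 * Real.exp (-((a + b) / 2 * t)) * s))
    rw [← integral_const_mul]
    refine setIntegral_mono_on (hF x).norm ((integrableOn_exp_neg_mul_mul_const
      (half_pos (add_pos ha hb)) 1).const_mul _) measurableSet_Ioi fun t (ht : 0 < t) => ?_
    have h0 := uiGamma_mul_uiGamma_term_nonneg ha hb hp hq ht.le x.1 x.2
    have hle := uiGamma_mul_uiGamma_term_le ha hb hp hq ht.le x.1 x.2
    have hFx : F x t = p x.1 * q x.2 * uiGamma x.1 (a * t) * uiGamma x.2 (b * t) *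
        (s / (1 + s * t)) := by simp only [F]; ring
    rw [hFx, Real.norm_of_nonneg (by positivity), one_mul, ← mul_assoc]
    exact mul_le_mul hle (div_one_add_mul_le hs ht.le) (by positivity) (h0.trans hle)
  have h := hasSum_integral_of_summable_integral_norm hF hF_sum
  have hval (x : ℕ × ℕ) : ∫ t in Set.Ioi (0 : ℝ), F x t = _ :=
    (integral_const_mul _ _).trans
      (congrArg _ (integral_uiGamma_mul_uiGamma_mul_div ha hb hs x.1 x.2))
  calc _ = ∫ t in Set.Ioi (0 : ℝ), ∑' x, F x t := by
        refine setIntegral_congr_fun measurableSet_Ioi fun t (ht : 0 < t) => ?_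
        rw [← (summable_uiGamma_mul_uiGamma ha hb hp hq hps hqs ht.le).tsum_prod, ← tsum_mul_right]
        exact tsum_congr fun x => by simp only [F]; ring
    _ = ∑' x, ∫ t in Set.Ioi (0 : ℝ), F x t := h.tsum_eq.symm
    _ = _ := by
        rw [h.summable.tsum_prod]
        simp only [hval]

end Series

lemma integral_div_one_add_mul {s z : ℝ} (hs : 0 < s) (hz : 0 ≤ z) :
    ∫ t in (0 : ℝ)..z, s / (1 + s * t) = Real.log (1 + s * z) := by
  have hpos : ∀ t ∈ Set.uIcc 0 z, 0 < 1 + s * t := fun t ht => by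
    rw [Set.uIcc_of_le hz] at ht
    nlinarith [mul_nonneg hs.le ht.1]
  rw [intervalIntegral.integral_eq_sub_of_hasDerivAt (f := fun t => Real.log (1 + s * t))]
  · simp
  · intro t ht
    simpa using (((hasDerivAt_id t).const_mul s).const_add 1).log (hpos t ht).ne'
  · exact (ContinuousOn.div (by fun_prop) (by fun_prop)
      fun t ht => (hpos t ht).ne').intervalIntegrable

lemma intervalIntegrable_div_one_add_mul {s z : ℝ} (hs : 0 < s) (hz : 0 ≤ z) :
    IntervalIntegrable (fun t => s / (1 + s * t)) volume 0 z := by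
  refine (ContinuousOn.div (by fun_prop) (by fun_prop) fun t ht => ?_).intervalIntegrable
  rw [Set.uIcc_of_le hz] at ht
  have := mul_nonneg hs.le ht.1
  positivity

/-- Layer-cake formula for `log (1 + s Z)` in terms of the tail of `Z`. -/
lemma integrable_log_and_integral_log_eq {Ω' : Type*} [MeasurableSpace Ω'] {μ : Measure Ω'}
    [IsFiniteMeasure μ] {Z : Ω' → ℝ} (hZ : Measurable Z) (hZ0 : ∀ ω, 0 ≤ Z ω) {s : ℝ} (hs : 0 < s)
    {T : ℝ → ℝ} (hT : ∀ z, 0 ≤ z → (μ {ω | z < Z ω}).toReal = T z)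
    (hint : IntegrableOn (fun t => T t * (s / (1 + s * t))) (Set.Ioi 0)) :
    Integrable (fun ω => Real.log (1 + s * Z ω)) μ ∧
      ∫ ω, Real.log (1 + s * Z ω) ∂μ = ∫ t in Set.Ioi 0, T t * (s / (1 + s * t)) := by
  have hg0 : ∀ᵐ t ∂volume.restrict (Set.Ioi (0 : ℝ)), 0 ≤ s / (1 + s * t) :=
    (ae_restrict_iff' measurableSet_Ioi).mpr (.of_forall fun t (ht : 0 < t) => by positivity)
  have hTg0 : 0 ≤ᵐ[volume.restrict (Set.Ioi (0 : ℝ))] fun t => T t * (s / (1 + s * t)) :=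
    (ae_restrict_iff' measurableSet_Ioi).mpr (.of_forall fun t (ht : 0 < t) => by
      have : 0 ≤ T t := hT t ht.le ▸ ENNReal.toReal_nonneg
      simp only [Pi.zero_apply]
      positivity)
  have hlog0 : ∀ ω, 0 ≤ Real.log (1 + s * Z ω) := fun ω =>
    Real.log_nonneg (by nlinarith [mul_nonneg hs.le (hZ0 ω)])
  have hmeas : AEStronglyMeasurable (fun ω => Real.log (1 + s * Z ω)) μ :=
    Measurable.aestronglyMeasurable (by fun_prop)
  have hlint : ∫⁻ ω, ENNReal.ofReal (Real.log (1 + s * Z ω)) ∂μ =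
      ENNReal.ofReal (∫ t in Set.Ioi 0, T t * (s / (1 + s * t))) := by
    rw [ofReal_integral_eq_lintegral_ofReal hint hTg0]
    calc _ = ∫⁻ ω, ENNReal.ofReal (∫ t in (0 : ℝ)..Z ω, s / (1 + s * t)) ∂μ := by
          simp only [integral_div_one_add_mul hs (hZ0 _)]
      _ = _ := lintegral_comp_eq_lintegral_meas_lt_mul μ (.of_forall hZ0) hZ.aemeasurable
          (fun t ht => intervalIntegrable_div_one_add_mul hs ht.le) hg0
      _ = _ := by
          refine setLIntegral_congr_fun measurableSet_Ioi fun t (ht : 0 < t) => ?_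
          rw [← hT t ht.le, ENNReal.ofReal_mul ENNReal.toReal_nonneg,
            ENNReal.ofReal_toReal (measure_ne_top _ _)]
  refine ⟨⟨hmeas, ?_⟩, ?_⟩
  · rw [hasFiniteIntegral_iff_ofReal (.of_forall hlog0), hlint]
    exact ENNReal.ofReal_lt_top
  · rw [integral_eq_lintegral_of_nonneg_ae (.of_forall hlog0) hmeas, hlint,
      ENNReal.toReal_ofReal (integral_nonneg_of_ae hTg0)]

lemma summable_rician_weights {K Ω a : ℝ} {B : ℕ → ℝ}
    (hB : ∀ n, B n = ((K * (1 + K) / Ω) ^ n / (n.factorial : ℝ) ^ 2) / a) :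
    Summable fun n => B n * n.factorial * 2 ^ n := by
  refine ((Real.summable_pow_div_factorial (K * (1 + K) / Ω * 2)).div_const a).congr fun n => ?_
  rw [hB, mul_pow]
  have : (n.factorial : ℝ) ≠ 0 := by positivity
  field_simp

/-- The average achievable rate of symbol `s₁` in the NOMA-based cooperative relaying
    system over Rician fading: if the nonnegative random variable `Z` has the tail
    `P(Z > z) = A_x A_y ∑_{n,k} B̃_x(n) B̃_y(k) Γ(n+1, a_x z) Γ(k+1, a_y z)`, then
    `C₁ = (1/2)·E[log₂(1+ρZ) - log₂(1+ρa₂Z)]` is finite and equals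
    `(1/(2 ln 2))·(D(ρ) - D(ρa₂))`. -/
theorem achievable_rate_s1 {Ω' : Type*} [MeasurableSpace Ω'] (μ : Measure Ω')
    [IsProbabilityMeasure μ] (Z : Ω' → ℝ) (hZ : Measurable Z) (hZnonneg : ∀ ω, 0 ≤ Z ω)
    (Kx Ky Ωx Ωy ρ a2 : ℝ)
    (hKx : 0 ≤ Kx) (hKy : 0 ≤ Ky) (hΩx : 0 < Ωx) (hΩy : 0 < Ωy)
    (hρ : 0 < ρ) (ha2 : 0 < a2) (ha2' : a2 < 1)
    (ax ay Ax Ay : ℝ) (Bx By : ℕ → ℝ) (D : ℝ → ℝ)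
    (hax : ax = (1 + Kx) / Ωx) (hay : ay = (1 + Ky) / Ωy)
    (hAx : Ax = ax * Real.exp (-Kx)) (hAy : Ay = ay * Real.exp (-Ky))
    (hBx : ∀ n, Bx n = ((Kx * (1 + Kx) / Ωx) ^ n / ((Nat.factorial n : ℝ)) ^ 2) / ax)
    (hBy : ∀ k, By k = ((Ky * (1 + Ky) / Ωy) ^ k / ((Nat.factorial k : ℝ)) ^ 2) / ay)
    (htail : ∀ z : ℝ, 0 ≤ z →
      (μ {ω | z < Z ω}).toReal
        = Ax * Ay * ∑' n : ℕ, ∑' k : ℕ,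
            Bx n * By k * uiGamma n (ax * z) * uiGamma k (ay * z))
    (hD : ∀ s : ℝ, 0 < s →
      D s = Ax * Ay * ∑' n : ℕ, ∑' k : ℕ,
        Bx n * By k * (Nat.factorial n : ℝ) * (Nat.factorial k : ℝ) *
        ∑ i ∈ Finset.range (n + 1), ∑ j ∈ Finset.range (k + 1),
          ((Nat.factorial (i + j) : ℝ) / ((Nat.factorial i : ℝ) * (Nat.factorial j : ℝ))) *
          (ax ^ i * ay ^ j / s ^ (i + j)) * Real.exp ((ax + ay) / s) *
          uiGammaNeg (i + j) ((ax + ay) / s)) :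
    Integrable (fun ω => Real.logb 2 (1 + ρ * Z ω) - Real.logb 2 (1 + ρ * a2 * Z ω)) μ ∧
    (1 / 2) * ∫ ω, (Real.logb 2 (1 + ρ * Z ω) - Real.logb 2 (1 + ρ * a2 * Z ω)) ∂μ
      = (1 / (2 * Real.log 2)) * (D ρ - D (ρ * a2)) := by
  have hax0 : 0 < ax := by rw [hax]; positivity
  have hay0 : 0 < ay := by rw [hay]; positivity
  have hBx0 : ∀ n, 0 ≤ Bx n := fun n => by rw [hBx]; positivity
  have hBy0 : ∀ k, 0 ≤ By k := fun k => by rw [hBy]; positivity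
  have hBxs := summable_rician_weights hBx
  have hBys := summable_rician_weights hBy
  have key : ∀ s, 0 < s → Integrable (fun ω => Real.log (1 + s * Z ω)) μ ∧
      ∫ ω, Real.log (1 + s * Z ω) ∂μ = D s := fun s hs => by
    have hint := (integrableOn_tsum_uiGamma_mul_div hax0 hay0 hs hBx0 hBy0 hBxs hBys).const_mul
      (Ax * Ay)
    simp only [← mul_assoc (Ax * Ay)] at hint
    obtain ⟨hlog, heq⟩ := integrable_log_and_integral_log_eq hZ hZnonneg hs htail hint
    refine ⟨hlog, heq.trans ?_⟩
    simp only [mul_assoc (Ax * Ay)]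
    rw [integral_const_mul, integral_tsum_uiGamma_mul_div hax0 hay0 hs hBx0 hBy0 hBxs hBys, hD s hs]
    simp only [mul_assoc]
  obtain ⟨h1, e1⟩ := key ρ hρ
  obtain ⟨h2, e2⟩ := key (ρ * a2) (mul_pos hρ ha2)
  simp only [Real.logb]
  refine ⟨(h1.div_const _).sub (h2.div_const _), ?_⟩
  rw [integral_sub (h1.div_const _) (h2.div_const _), integral_div, integral_div, e1, e2]
  ring
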